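/- arXiv:1910.09426 — 9 statements merged into one kernel-verified Lean document; each statement's English description precedes it below -/
import Mathlib

section
/- Let K be a field, P = K[x_1,…,x_n], and let O = {t_1,…,t_μ} be an order ideal in the monomials of P with border ∂O = {b_1,…,b_ν}. Let G = {g_1,…,g_ν} be the generic O-border prebasis over K[C], and let B_O = K[C]/I(B_O) and U_O = B_O[x_1,…,x_n]/⟨g_1,…,g_ν⟩. Then U_O is a free B_O-module and the residue classes of t_1,…,t_μ form a B_O-module basis of U_O. -/
open MvPolynomial

noncomputable section

/-- The (total) degree of an exponent vector, i.e. of the corresponding monomial. -/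
def edeg {n : ℕ} (d : Fin n →₀ ℕ) : ℕ := d.sum fun _ e => e

/-- Evaluation of polynomials at pairwise commuting elements of an algebra. -/
theorem exists_eval_of_commute {R M σ : Type*} [CommRing R] [Ring M] [Algebra R M]
    (N : σ → M) (hN : ∀ r s, N r * N s = N s * N r) :
    ∃ ψ : MvPolynomial σ R →ₐ[R] M, ∀ r, ψ (X r) = N r := by
  letI : CommRing (Algebra.adjoin R (Set.range N)) :=
    Algebra.adjoinCommRingOfComm R (by
      rintro _ ⟨r, rfl⟩ _ ⟨s, rfl⟩
      exact hN r s)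
  let φ : MvPolynomial σ R →ₐ[R] Algebra.adjoin R (Set.range N) :=
    aeval (fun r => (⟨N r, Algebra.subset_adjoin ⟨r, rfl⟩⟩ : Algebra.adjoin R (Set.range N)))
  refine ⟨(Algebra.adjoin R (Set.range N)).val.comp φ, fun r => ?_⟩
  simp [φ]

/-- Let `K` be a field, `P = K[x_1,…,x_n]`, and let `O = {t_1,…,t_μ}` be an
order ideal with border `∂O = {b_1,…,b_ν}`.  Let `G = {g_1,…,g_ν}` be the generic `O`-border
prebasis over `K[C]`, let `I(B_O)` be the defining ideal of the border basis scheme (generated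
by the entries of the commutators of the generic multiplication matrices), and let
`U_O = B_O[x_1,…,x_n]/⟨g_1,…,g_ν⟩` where `B_O = K[C]/I(B_O)`.  Then `U_O` is a free
`B_O`-module with basis given by the residue classes of `t_1,…,t_μ`: every element of `U_O`
is a `B_O`-linear combination of these classes, and the coefficients of such a representation
are unique modulo `I(B_O)`. -/
theorem universal_border_basis_family_is_free_with_basis_O
    (K : Type*) [Field K] (n μ ν : ℕ) (hμ : 0 < μ)
    (t : Fin μ → (Fin n →₀ ℕ)) (b : Fin ν → (Fin n →₀ ℕ))
    -- `t` enumerates an order ideal `O` (closed under division), with nondecreasing degrees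
    (htinj : Function.Injective t)
    (horder : ∀ (i : Fin μ) (d : Fin n →₀ ℕ), d ≤ t i → ∃ j, t j = d)
    (hsort : Monotone fun i => edeg (t i))
    -- `b` enumerates the border `∂O = (x_1·O ∪ … ∪ x_n·O) \ O`
    (hbinj : Function.Injective b)
    (hborder : ∀ d : Fin n →₀ ℕ,
      (∃ j, b j = d) ↔
        ((∃ (r : Fin n) (i : Fin μ), d = Finsupp.single r 1 + t i) ∧ ∀ i, t i ≠ d))
    -- the generic multiplication matrices `A_1, …, A_n` over `K[C]`
    (A : Fin n → Matrix (Fin μ) (Fin μ) (MvPolynomial (Fin μ × Fin ν) K))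
    (hAt : ∀ (r : Fin n) (i j m : Fin μ), Finsupp.single r 1 + t j = t m →
      A r i j = if i = m then 1 else 0)
    (hAb : ∀ (r : Fin n) (i j : Fin μ) (m : Fin ν), Finsupp.single r 1 + t j = b m →
      A r i j = X (i, m))
    -- `I(B_O)` is generated by the entries of the commutators `A_r A_s - A_s A_r`, `r < s`
    (IBO : Ideal (MvPolynomial (Fin μ × Fin ν) K))
    (hIBO : IBO = Ideal.span {p | ∃ r s : Fin n, r < s ∧
      ∃ i j : Fin μ, p = (A r * A s - A s * A r) i j})
    -- the generic `O`-border prebasis `G = {g_1,…,g_ν}` in `K[C][x_1,…,x_n]`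
    (g : Fin ν → MvPolynomial (Fin n) (MvPolynomial (Fin μ × Fin ν) K))
    (hg : ∀ j, g j = monomial (b j) 1 - ∑ i : Fin μ, C (X (i, j)) * monomial (t i) 1)
    -- `U_O = K[C][x_1,…,x_n] / (⟨g_1,…,g_ν⟩ + I(B_O)·K[C][x_1,…,x_n])`
    (J : Ideal (MvPolynomial (Fin n) (MvPolynomial (Fin μ × Fin ν) K)))
    (hJ : J = Ideal.span (Set.range g) ⊔
      Ideal.map (C : MvPolynomial (Fin μ × Fin ν) K →+*
        MvPolynomial (Fin n) (MvPolynomial (Fin μ × Fin ν) K)) IBO) :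
    -- the residue classes of `t_1,…,t_μ` span `U_O` over `K[C]` …
    (∀ u : MvPolynomial (Fin n) (MvPolynomial (Fin μ × Fin ν) K) ⧸ J,
      ∃ p : Fin μ → MvPolynomial (Fin μ × Fin ν) K,
        u = ∑ i : Fin μ, p i • Ideal.Quotient.mk J (monomial (t i) 1)) ∧
    -- … and a representation is unique modulo `I(B_O)`; i.e. the residue classes of
    -- `t_1,…,t_μ` form a basis of `U_O` as a (free) module over `B_O = K[C]/I(B_O)`.
    (∀ p q : Fin μ → MvPolynomial (Fin μ × Fin ν) K,
      (∑ i : Fin μ, p i • Ideal.Quotient.mk J (monomial (t i) 1)) =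
        (∑ i : Fin μ, q i • Ideal.Quotient.mk J (monomial (t i) 1)) →
      ∀ i, p i - q i ∈ IBO) := by
  have hmulb : ∀ (r : Fin n) (j : Fin μ),
      (∃ m, Finsupp.single r 1 + t j = t m) ∨ (∃ m, Finsupp.single r 1 + t j = b m) := by
    intro r j
    by_cases h : ∃ m, t m = Finsupp.single r 1 + t j
    · obtain ⟨m, hm⟩ := h
      exact Or.inl ⟨m, hm.symm⟩
    · push Not at h
      obtain ⟨m, hm⟩ := (hborder (Finsupp.single r 1 + t j)).2 ⟨⟨r, j, rfl⟩, h⟩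
      exact Or.inr ⟨m, hm.symm⟩
  obtain ⟨i0, hi0⟩ : ∃ i, t i = 0 := horder ⟨0, hμ⟩ 0 (fun _ => Nat.zero_le _)
  have hgJ : ∀ j, g j ∈ J := fun j => by
    rw [hJ]
    exact Ideal.mem_sup_left (Ideal.subset_span ⟨j, rfl⟩)
  have hsm : ∀ (c : MvPolynomial (Fin μ × Fin ν) K)
      (f : MvPolynomial (Fin n) (MvPolynomial (Fin μ × Fin ν) K)),
      c • Ideal.Quotient.mk J f = Ideal.Quotient.mk J (C c * f) := by
    intro c f
    rw [← smul_eq_C_mul]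
    rfl
  constructor
  · have hX : ∀ r j, Ideal.Quotient.mk J (monomial (t j) 1) * Ideal.Quotient.mk J (X r) =
        ∑ i, A r i j • Ideal.Quotient.mk J (monomial (t i) 1) := by
      intro r j
      rw [← map_mul, mul_comm, X, monomial_mul, one_mul]
      rcases hmulb r j with ⟨m, hm⟩ | ⟨m, hm⟩
      · rw [hm]
        simp_rw [hAt r _ j m hm]
        simp
      · rw [hm]
        simp_rw [hAb r _ j m hm, hsm]
        rw [← map_sum, Ideal.Quotient.eq, ← hg]
        exact hgJ m
    have key : ∀ u : MvPolynomial (Fin n) (MvPolynomial (Fin μ × Fin ν) K),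
        Ideal.Quotient.mk J u ∈ Submodule.span (MvPolynomial (Fin μ × Fin ν) K)
          (Set.range fun i => Ideal.Quotient.mk J (monomial (t i) 1)) := by
      intro u
      induction u using MvPolynomial.induction_on with
      | C c =>
        have : Ideal.Quotient.mk J (C c) = c • Ideal.Quotient.mk J (monomial (t i0) 1) := by
          rw [hsm, hi0]
          simp
        rw [this]
        exact Submodule.smul_mem _ _ (Submodule.subset_span ⟨i0, rfl⟩)
      | add p q hp hq =>
        rw [map_add]
        exact Submodule.add_mem _ hp hq
      | mul_X p r hp =>
        rw [map_mul]
        obtain ⟨c, hc⟩ := (Submodule.mem_span_range_iff_exists_fun _).1 hp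
        rw [← hc, Finset.sum_mul]
        refine Submodule.sum_mem _ fun j _ => ?_
        rw [smul_mul_assoc, hX]
        refine Submodule.smul_mem _ _ (Submodule.sum_mem _ fun i _ => ?_)
        exact Submodule.smul_mem _ _ (Submodule.subset_span ⟨i, rfl⟩)
    intro u
    obtain ⟨u, rfl⟩ := Ideal.Quotient.mk_surjective u
    obtain ⟨c, hc⟩ := (Submodule.mem_span_range_iff_exists_fun _).1 (key u)
    exact ⟨c, hc.symm⟩
  · let π := Ideal.Quotient.mk IBO
    let N : Fin n → Matrix (Fin μ) (Fin μ) (MvPolynomial (Fin μ × Fin ν) K ⧸ IBO) :=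
      fun r => (A r).map π
    have hlt : ∀ r s, r < s → N r * N s = N s * N r := by
      intro r s h
      simp only [N]
      rw [← Matrix.map_mul, ← Matrix.map_mul]
      ext i j
      simp only [Matrix.map_apply]
      refine Ideal.Quotient.eq.2 ?_
      rw [← Matrix.sub_apply, hIBO]
      exact Ideal.subset_span ⟨r, s, h, i, j, rfl⟩
    have hN : ∀ r s, N r * N s = N s * N r := by
      intro r s
      rcases lt_trichotomy r s with h | h | h
      · exact hlt r s h
      · rw [h]
      · exact (hlt s r h).symm
    obtain ⟨ψ, hψ⟩ := exists_eval_of_commute (R := MvPolynomial (Fin μ × Fin ν) K) N hN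
    let e : Fin μ → Fin μ → (MvPolynomial (Fin μ × Fin ν) K ⧸ IBO) := fun i => Pi.single i 1
    have hψC : ∀ c v, (ψ (C c)).mulVec v = π c • v := by
      intro c v
      have : ψ (C c) = π c • (1 : Matrix (Fin μ) (Fin μ) _) := by
        rw [← algebraMap_eq, AlgHom.commutes, Algebra.algebraMap_eq_smul_one]
        ext i j
        rw [Matrix.smul_apply, Matrix.smul_apply, Algebra.smul_def]
        rfl
      rw [this, Matrix.smul_mulVec, Matrix.one_mulVec]
    have hNe : ∀ r j, (N r).mulVec (e j) = fun i => π (A r i j) := by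
      intro r j
      ext i
      simp [e, N]
    have ht : ∀ (k : ℕ) (i : Fin μ), edeg (t i) = k →
        (ψ (monomial (t i) 1)).mulVec (e i0) = e i := by
      intro k
      induction k with
      | zero =>
        intro i hi
        have h0 : t i = 0 := by
          ext r
          by_contra hne
          have := (Finset.sum_eq_zero_iff.1 hi) r (by simpa using hne)
          exact hne this
        have : i = i0 := htinj (h0.trans hi0.symm)
        subst this
        rw [h0]
        have h1 : (monomial 0 1 : MvPolynomial (Fin n) (MvPolynomial (Fin μ × Fin ν) K)) = 1 := rfl
        rw [h1, map_one, Matrix.one_mulVec]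
      | succ k ih =>
        intro i hi
        have hne : t i ≠ 0 := by
          intro h
          rw [h] at hi
          simp [edeg] at hi
        obtain ⟨r, hr⟩ := Finsupp.ne_iff.1 hne
        have hle : Finsupp.single r 1 ≤ t i := by
          rw [Finsupp.single_le_iff]
          exact Nat.one_le_iff_ne_zero.2 hr
        obtain ⟨j, hj⟩ := horder i (t i - Finsupp.single r 1) tsub_le_self
        have hij : Finsupp.single r 1 + t j = t i := by
          rw [hj]
          exact add_tsub_cancel_of_le hle
        have hdeg : edeg (t j) = k := by
          have h2 : edeg (Finsupp.single r 1 + t j) = 1 + edeg (t j) := by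
            unfold edeg
            rw [Finsupp.sum_add_index' (fun _ => rfl) (fun _ _ _ => rfl)]
            simp
          rw [hij, hi] at h2
          omega
        have hm : (monomial (t i) 1 : MvPolynomial (Fin n) (MvPolynomial (Fin μ × Fin ν) K)) =
            X r * monomial (t j) 1 := by
          rw [X, monomial_mul, one_mul, hij]
        rw [hm, map_mul, hψ, ← Matrix.mulVec_mulVec, ih j hdeg, hNe]
        ext l
        rw [hAt r l j i hij]
        by_cases hl : l = i
        · simp [e, hl]
        · simp [e, hl]
    have hlin : ∀ c : Fin μ → MvPolynomial (Fin μ × Fin ν) K,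
        (ψ (∑ i, C (c i) * monomial (t i) 1)).mulVec (e i0) = fun i => π (c i) := by
      intro c
      rw [map_sum, Matrix.sum_mulVec]
      simp_rw [map_mul, ← Matrix.mulVec_mulVec, ht _ _ rfl, hψC]
      ext l
      simp [e, Finset.sum_apply, Pi.single_apply]
    have hgz : ∀ j, (ψ (g j)).mulVec (e i0) = 0 := by
      intro m
      obtain ⟨⟨r, j, hrj⟩, -⟩ := (hborder (b m)).1 ⟨m, rfl⟩
      have hm : (monomial (b m) 1 : MvPolynomial (Fin n) (MvPolynomial (Fin μ × Fin ν) K)) =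
            X r * monomial (t j) 1 := by
        rw [X, monomial_mul, one_mul, hrj]
      rw [hg, map_sub, Matrix.sub_mulVec, hlin, hm, map_mul, hψ, ← Matrix.mulVec_mulVec,
        ht _ _ rfl, hNe]
      ext l
      rw [Pi.sub_apply, hAb r l j m hrj.symm, sub_self]
      rfl
    let Z : Ideal (MvPolynomial (Fin n) (MvPolynomial (Fin μ × Fin ν) K)) :=
      { carrier := {f | (ψ f).mulVec (e i0) = 0}
        add_mem' := by
          intro f h hf hh
          simp only [Set.mem_ofPred_eq] at *
          rw [map_add, Matrix.add_mulVec, hf, hh, add_zero]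
        zero_mem' := by
          simp only [Set.mem_ofPred_eq]
          rw [map_zero, Matrix.zero_mulVec]
        smul_mem' := by
          intro f h hh
          simp only [Set.mem_ofPred_eq] at *
          rw [smul_eq_mul, map_mul, ← Matrix.mulVec_mulVec, hh, Matrix.mulVec_zero] }
    have hJZ : J ≤ Z := by
      rw [hJ]
      refine sup_le (Ideal.span_le.2 ?_) (Ideal.map_le_iff_le_comap.2 ?_)
      · rintro _ ⟨j, rfl⟩
        exact hgz j
      · intro c hc
        change (ψ (C c)).mulVec (e i0) = 0
        have h0 : π c = 0 := Ideal.Quotient.eq_zero_iff_mem.2 hc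
        rw [hψC]
        ext l
        rw [Pi.smul_apply, h0, smul_eq_mul]
        exact zero_mul _
    intro p q hpq i
    simp_rw [hsm] at hpq
    rw [← map_sum, ← map_sum, Ideal.Quotient.eq, ← Finset.sum_sub_distrib] at hpq
    simp_rw [← sub_mul, ← C_sub] at hpq
    have hz : (ψ (∑ i, C (p i - q i) * monomial (t i) 1)).mulVec (e i0) = 0 := hJZ hpq
    rw [hlin] at hz
    exact Ideal.Quotient.eq_zero_iff_mem.1 (congrFun hz i)
end
end

section
/- Let K be a field, P = K[x_1,…,x_n], O = {t_1,…,t_μ} an order ideal with border ∂O = {b_1,…,b_ν}, and A_1,…,A_n the generic multiplication matrices over K[C]. Equip K[C] with the total arrow degree grading deg(c_{ij}) = deg(b_j) − deg(t_i) ∈ ℤ. Then for all 1 ≤ r < s ≤ n and all 1 ≤ i, j ≤ μ, the (i,j) entry of the commutator A_r A_s − A_s A_r is a homogeneous polynomial with respect to the total arrow degree (of degree deg(t_j) + 2 − deg(t_i) if it is nonzero). In particular, the ideal I(B_O) generated by all these entries is a homogeneous ideal of K[C] with respect to the total arrow degree. -/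
open MvPolynomial

noncomputable section

/-- Let `O = {t_1,…,t_μ}` be an order ideal with border `∂O = {b_1,…,b_ν}`
and let `A_1,…,A_n` be the generic multiplication matrices over `K[C]`.  Equip `K[C]` with the
total arrow degree grading, `deg(c_{ij}) = deg(b_j) - deg(t_i) ∈ ℤ`.  Then every entry of a
commutator `A_r A_s - A_s A_r` (for `r < s`) is homogeneous with respect to the total arrow
degree, the `(i,j)` entry having degree `deg(t_j) + 2 - deg(t_i)` (if nonzero); in particular
the defining ideal `I(B_O)` of the border basis scheme is a homogeneous ideal of `K[C]` with
respect to the total arrow degree, i.e. it contains all the weighted homogeneous components of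
each of its elements. -/
theorem commutator_entries_arrow_degree_homogeneous
    (K : Type*) [Field K] (n μ ν : ℕ) (hμ : 0 < μ)
    (t : Fin μ → (Fin n →₀ ℕ)) (b : Fin ν → (Fin n →₀ ℕ))
    -- `t` enumerates an order ideal `O` (closed under division), with nondecreasing degrees
    (htinj : Function.Injective t)
    (horder : ∀ (i : Fin μ) (d : Fin n →₀ ℕ), d ≤ t i → ∃ j, t j = d)
    (hsort : Monotone fun i => edeg (t i))
    -- `b` enumerates the border `∂O = (x_1·O ∪ … ∪ x_n·O) \ O`
    (hbinj : Function.Injective b)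
    (hborder : ∀ d : Fin n →₀ ℕ,
      (∃ j, b j = d) ↔
        ((∃ (r : Fin n) (i : Fin μ), d = Finsupp.single r 1 + t i) ∧ ∀ i, t i ≠ d))
    -- the generic multiplication matrices `A_1, …, A_n` over `K[C]`
    (A : Fin n → Matrix (Fin μ) (Fin μ) (MvPolynomial (Fin μ × Fin ν) K))
    (hAt : ∀ (r : Fin n) (i j m : Fin μ), Finsupp.single r 1 + t j = t m →
      A r i j = if i = m then 1 else 0)
    (hAb : ∀ (r : Fin n) (i j : Fin μ) (m : Fin ν), Finsupp.single r 1 + t j = b m →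
      A r i j = X (i, m))
    -- `I(B_O)` is generated by the entries of the commutators `A_r A_s - A_s A_r`, `r < s`
    (IBO : Ideal (MvPolynomial (Fin μ × Fin ν) K))
    (hIBO : IBO = Ideal.span {p | ∃ r s : Fin n, r < s ∧
      ∃ i j : Fin μ, p = (A r * A s - A s * A r) i j})
    -- the total arrow degree: the weight of the variable `c_{ij}` is `deg(b_j) - deg(t_i)`
    (w : Fin μ × Fin ν → ℤ)
    (hw : ∀ v, w v = (edeg (b v.2) : ℤ) - (edeg (t v.1) : ℤ)) :
    (∀ r s : Fin n, r < s → ∀ i j : Fin μ,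
      ((A r * A s - A s * A r) i j).IsWeightedHomogeneous w
        ((edeg (t j) : ℤ) + 2 - (edeg (t i) : ℤ))) ∧
    (∀ (d : ℤ) (p : MvPolynomial (Fin μ × Fin ν) K), p ∈ IBO →
      weightedHomogeneousComponent w d p ∈ IBO) := by
  have hdeg : ∀ (r : Fin n) (d : Fin n →₀ ℕ), edeg (Finsupp.single r 1 + d) = edeg d + 1 := by
    intro r d
    unfold edeg
    rw [Finsupp.sum_add_index' (fun _ => rfl) (fun _ _ _ => rfl),
      Finsupp.sum_single_index rfl, add_comm]
  have hA : ∀ (r : Fin n) (i j : Fin μ), (A r i j).IsWeightedHomogeneous w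
      ((edeg (t j) : ℤ) + 1 - (edeg (t i) : ℤ)) := by
    intro r i j
    by_cases h : ∃ m, t m = Finsupp.single r 1 + t j
    · obtain ⟨m, hm⟩ := h
      rw [hAt r i j m hm.symm]
      have h1 := hdeg r (t j)
      rw [← hm] at h1
      split_ifs with him
      · subst him
        have h0 : (edeg (t j) : ℤ) + 1 - (edeg (t i) : ℤ) = 0 := by omega
        rw [h0]
        exact isWeightedHomogeneous_one K w
      · exact isWeightedHomogeneous_zero K w _
    · obtain ⟨m, hm⟩ := (hborder (Finsupp.single r 1 + t j)).2
        ⟨⟨r, j, rfl⟩, fun i hi => h ⟨i, hi⟩⟩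
      rw [hAb r i j m hm.symm]
      have h1 := hdeg r (t j)
      rw [← hm] at h1
      have h0 : (edeg (t j) : ℤ) + 1 - (edeg (t i) : ℤ) = w (i, m) := by
        rw [hw]
        simp only
        omega
      rw [h0]
      exact isWeightedHomogeneous_X K w _
  have hAA : ∀ (r s : Fin n) (i j : Fin μ), ((A r * A s) i j).IsWeightedHomogeneous w
      ((edeg (t j) : ℤ) + 2 - (edeg (t i) : ℤ)) := by
    intro r s i j
    rw [Matrix.mul_apply]
    refine IsWeightedHomogeneous.sum _ _ _ fun k _ => ?_
    have h := (hA r i k).mul (hA s k j)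
    convert h using 1
    ring
  have hC : ∀ r s : Fin n, r < s → ∀ i j : Fin μ,
      ((A r * A s - A s * A r) i j).IsWeightedHomogeneous w
        ((edeg (t j) : ℤ) + 2 - (edeg (t i) : ℤ)) := by
    intro r s _ i j
    rw [Matrix.sub_apply]
    exact (hAA r s i j).sub (hAA s r i j)
  refine ⟨hC, fun d p hp => ?_⟩
  letI := weightedGradedAlgebra K w
  refine weightedHomogeneousComponent_mem_of_mem K w ?_ hp d
  rw [hIBO]
  refine Ideal.homogeneous_span _ _ ?_
  rintro _ ⟨r, s, hrs, i, j, rfl⟩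
  exact ⟨_, hC r s hrs i j⟩
end
end

section
/- Let K be a field, P = K[x_1,…,x_n], and O = {t_1,…,t_μ} an order ideal with deg(t_1) ≤ … ≤ deg(t_μ) and border ∂O = {b_1,…,b_ν} ordered so that deg(b_1) ≤ … ≤ deg(b_ν). Assume deg(t_μ) > deg(b_1). Then the O-border prebasis G = {b_1 − t_μ, b_2, …, b_ν} is an O-border basis of the ideal I = ⟨b_1 − t_μ, b_2, …, b_ν⟩ it generates; that is, the residue classes of t_1,…,t_μ form a K-vector-space basis of P/I. -/
open MvPolynomial

noncomputable section

theorem edeg_add_aux {n : ℕ} (c d : Fin n →₀ ℕ) : edeg (c + d) = edeg c + edeg d := by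
  have h : ∀ e : Fin n →₀ ℕ, edeg e = Finsupp.degree e := fun e => rfl
  rw [h, h, h, map_add]

theorem edeg_eq_zero_aux {n : ℕ} (c : Fin n →₀ ℕ) (hc : edeg c = 0) : c = 0 := by
  have h : edeg c = Finsupp.degree c := rfl
  rw [h] at hc
  exact (Finsupp.degree_eq_zero_iff c).1 hc

theorem exists_single_add_aux {n : ℕ} (d : Fin n →₀ ℕ) (hd : d ≠ 0) :
    ∃ (r : Fin n) (c : Fin n →₀ ℕ), d = Finsupp.single r 1 + c := by
  obtain ⟨r, hr⟩ := Finsupp.ne_iff.1 hd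
  refine ⟨r, d - Finsupp.single r 1, ?_⟩
  rw [add_tsub_cancel_of_le]
  rw [Finsupp.single_le_iff]
  simp at hr
  omega

/-- Let `O = {t_1,…,t_μ}` be an order ideal with `deg(t_1) ≤ … ≤ deg(t_μ)`
and border `∂O = {b_1,…,b_ν}` ordered so that `deg(b_1) ≤ … ≤ deg(b_ν)`.  Assume
`deg(t_μ) > deg(b_1)`.  Then the `O`-border prebasis `G = {b_1 - t_μ, b_2, …, b_ν}` is an
`O`-border basis of the ideal `I = ⟨G⟩` it generates: the residue classes of `t_1,…,t_μ`
form a `K`-vector-space basis of `P/I`. -/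
theorem border_prebasis_b1_sub_tmu_is_border_basis
    (K : Type*) [Field K] (n μ ν : ℕ) (hμ : 0 < μ) (hν : 0 < ν)
    (t : Fin μ → (Fin n →₀ ℕ)) (b : Fin ν → (Fin n →₀ ℕ))
    -- `t` enumerates an order ideal `O` (closed under division), with nondecreasing degrees
    (htinj : Function.Injective t)
    (horder : ∀ (i : Fin μ) (d : Fin n →₀ ℕ), d ≤ t i → ∃ j, t j = d)
    (hsortt : Monotone fun i => edeg (t i))
    -- `b` enumerates the border `∂O = (x_1·O ∪ … ∪ x_n·O) \ O`, with nondecreasing degrees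
    (hbinj : Function.Injective b)
    (hborder : ∀ d : Fin n →₀ ℕ,
      (∃ j, b j = d) ↔
        ((∃ (r : Fin n) (i : Fin μ), d = Finsupp.single r 1 + t i) ∧ ∀ i, t i ≠ d))
    (hsortb : Monotone fun j => edeg (b j))
    -- assume `deg(t_μ) > deg(b_1)`
    (hdeg : edeg (b ⟨0, hν⟩) < edeg (t ⟨μ - 1, Nat.sub_lt hμ Nat.one_pos⟩))
    -- the border prebasis `G = {b_1 - t_μ, b_2, …, b_ν}` and the ideal it generates
    (g : Fin ν → MvPolynomial (Fin n) K)
    (hg : ∀ j : Fin ν, g j =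
      if j = ⟨0, hν⟩ then
        monomial (b j) 1 - monomial (t ⟨μ - 1, Nat.sub_lt hμ Nat.one_pos⟩) 1
      else monomial (b j) 1)
    (I : Ideal (MvPolynomial (Fin n) K)) (hI : I = Ideal.span (Set.range g)) :
    LinearIndependent K
      (fun i : Fin μ => Ideal.Quotient.mk I (monomial (t i) 1)) ∧
    Submodule.span K
      (Set.range fun i : Fin μ => Ideal.Quotient.mk I (monomial (t i) 1)) = ⊤ := by
  classical
  set z : Fin ν := ⟨0, hν⟩ with hz
  set L : Fin μ := ⟨μ - 1, Nat.sub_lt hμ Nat.one_pos⟩ with hL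
  have hmax : ∀ i, edeg (t i) ≤ edeg (t L) := fun i => hsortt (by
    rw [Fin.le_def]; simp only [hL]; have := i.2; omega)
  have hmin : ∀ j, edeg (b z) ≤ edeg (b j) := fun j => hsortb (by
    rw [Fin.le_def]; simp [hz])
  have hbO : ∀ j i, t i ≠ b j := fun j => ((hborder (b j)).1 ⟨j, rfl⟩).2
  have hmb : ∀ m j i, t i ≠ m + b j := by
    intro m j i h
    obtain ⟨k, hk⟩ := horder i (b j) (by rw [h]; exact le_add_self)
    exact hbO j k hk
  -- every monomial outside the order ideal is a multiple of a border monomial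
  have hmul : ∀ N (d : Fin n →₀ ℕ), edeg d = N → (∀ i, t i ≠ d) → ∃ m j, d = m + b j := by
    intro N
    induction N with
    | zero =>
      intro d hd h
      obtain ⟨k, hk⟩ := horder L 0 zero_le
      exact absurd (hk.trans (edeg_eq_zero_aux d hd).symm) (h k)
    | succ N ih =>
      intro d hd h
      have hd0 : d ≠ 0 := by
        rintro rfl
        simp [edeg] at hd
      obtain ⟨r, c, rfl⟩ := exists_single_add_aux d hd0
      by_cases hc : ∃ i, t i = c
      · obtain ⟨i, rfl⟩ := hc
        obtain ⟨j, hj⟩ := (hborder _).2 ⟨⟨r, i, rfl⟩, h⟩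
        exact ⟨0, j, by rw [hj, zero_add]⟩
      · push Not at hc
        have h1 : edeg (Finsupp.single r 1 : Fin n →₀ ℕ) = 1 := by simp [edeg]
        rw [edeg_add_aux, h1] at hd
        obtain ⟨m, j, rfl⟩ := ih c (by omega) hc
        exact ⟨Finsupp.single r 1 + m, j, by rw [add_assoc]⟩
  have hgz : g z = monomial (b z) 1 - monomial (t L) 1 := by rw [hg, if_pos rfl]
  have hgn : ∀ j, j ≠ z → g j = monomial (b j) 1 := fun j hj => by rw [hg, if_neg hj]
  have hgI : ∀ j, g j ∈ I := fun j => by rw [hI]; exact Ideal.subset_span ⟨j, rfl⟩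
  have hmon : ∀ m c : Fin n →₀ ℕ, (monomial (m + c) (1 : K)) = monomial m 1 * monomial c 1 := by
    intro m c
    rw [monomial_mul, one_mul]
  have hnI : ∀ m j, j ≠ z → monomial (m + b j) (1 : K) ∈ I := by
    intro m j hj
    rw [hmon, ← hgn j hj]
    exact I.mul_mem_left _ (hgI j)
  -- proper multiples of `b_1` lie in `I`
  have hzI : ∀ m, m ≠ 0 → monomial (m + b z) (1 : K) ∈ I := by
    intro m hm
    obtain ⟨r, c, rfl⟩ := exists_single_add_aux m hm
    have h1 : edeg (Finsupp.single r 1 : Fin n →₀ ℕ) = 1 := by simp [edeg]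
    obtain ⟨j, hj⟩ := (hborder (Finsupp.single r 1 + t L)).2 ⟨⟨r, L, rfl⟩, by
      intro i hi
      have := hmax i
      rw [hi, edeg_add_aux, h1] at this
      omega⟩
    have hjz : j ≠ z := by
      rintro rfl
      rw [hj, edeg_add_aux, h1] at hdeg
      omega
    have h2 := hnI c j hjz
    rw [hj] at h2
    have h3 := I.mul_mem_left (monomial (Finsupp.single r 1 + c) (1 : K)) (hgI z)
    rw [hgz, mul_sub, ← hmon, ← hmon] at h3
    rw [← add_assoc, add_comm c] at h2
    have h4 := I.add_mem h3 h2
    rwa [sub_add_cancel] at h4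
  constructor
  · let φ : Fin μ → MvPolynomial (Fin n) K →ₗ[K] K := fun i =>
      lcoeff K (t i) + if i = L then lcoeff K (b z) else 0
    have hφ : ∀ i d, φ i (monomial d 1) =
        (if d = t i then 1 else 0) + (if i = L then (if d = b z then 1 else 0) else 0) := by
      intro i d
      by_cases hi : i = L <;> simp [φ, hi, coeff_monomial]
    have hφ0 : ∀ i d, (∀ k, t k ≠ d) → d ≠ b z → φ i (monomial d 1) = 0 := by
      intro i d h1 h2
      rw [hφ, if_neg (fun h => h1 i h.symm), if_neg h2]
      simp
    have hφg : ∀ i m j, φ i (monomial m 1 * g j) = 0 := by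
      intro i m j
      by_cases hj : j = z
      · subst hj
        rw [hgz, mul_sub, ← hmon, ← hmon, map_sub]
        by_cases hm : m = 0
        · subst hm
          rw [zero_add, zero_add, hφ, hφ, if_neg (fun h => hbO _ i h.symm), if_neg (hbO _ L)]
          by_cases hi : i = L
          · simp [hi]
          · simp [hi, htinj.eq_iff, Ne.symm hi]
        · have hpos : 0 < edeg m := Nat.pos_of_ne_zero fun h => hm (edeg_eq_zero_aux m h)
          rw [hφ0 i _ (hmb m _), hφ0 i, sub_zero]
          · intro k hk
            have := hmax k
            rw [hk, edeg_add_aux] at this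
            omega
          · intro h
            rw [← h, edeg_add_aux] at hdeg
            omega
          · intro h
            exact hm (by simpa using h)
      · rw [hgn j hj, ← hmon]
        apply hφ0 i _ (hmb m j)
        intro h
        have h1 := hmin j
        rw [← h, edeg_add_aux] at h1
        have hm := edeg_eq_zero_aux m (by omega)
        rw [hm, zero_add] at h
        exact hj (hbinj h)
    have hφq : ∀ i j q, φ i (q * g j) = 0 := by
      intro i j q
      induction q using MvPolynomial.induction_on' with
      | monomial u a =>
        have : monomial u a = a • monomial u (1 : K) := by rw [smul_monomial, smul_eq_mul, mul_one]
        rw [this, smul_mul_assoc, map_smul, hφg, smul_zero]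
      | add p q hp hq => rw [add_mul, map_add, hp, hq, add_zero]
    have hφI : ∀ i p, p ∈ I → φ i p = 0 := by
      intro i p hp
      rw [hI] at hp
      have : ∀ q, φ i (q * p) = 0 := by
        induction hp using Submodule.span_induction with
        | mem x hx =>
          obtain ⟨j, rfl⟩ := hx
          exact hφq i j
        | zero => intro q; simp
        | add x y _ _ hx hy => intro q; rw [mul_add, map_add, hx, hy, add_zero]
        | smul a x _ hx => intro q; rw [smul_eq_mul, ← mul_assoc]; exact hx _
      simpa using this 1
    rw [Fintype.linearIndependent_iff]
    intro c hc i
    have hmem : ∑ k, c k • monomial (t k) (1 : K) ∈ I := by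
      rw [← Ideal.Quotient.eq_zero_iff_mem, ← hc, map_sum]
      rfl
    have h := hφI i _ hmem
    rw [map_sum] at h
    have h2 : ∀ k, φ i (c k • monomial (t k) (1 : K)) = if k = i then c k else 0 := by
      intro k
      rw [map_smul, hφ, if_neg (hbO z k)]
      simp [htinj.eq_iff]
    simpa [h2] using h
  · rw [eq_top_iff]
    rintro x -
    obtain ⟨p, rfl⟩ := Ideal.Quotient.mk_surjective x
    induction p using MvPolynomial.induction_on' with
    | add p q hp hq => rw [map_add]; exact Submodule.add_mem _ hp hq
    | monomial d a =>
      have h0 : Ideal.Quotient.mk I (monomial d a)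
          = a • Ideal.Quotient.mk I (monomial d (1 : K)) := by
        have : monomial d a = a • monomial d (1 : K) := by rw [smul_monomial, smul_eq_mul, mul_one]
        rw [this]
        rfl
      rw [h0]
      apply Submodule.smul_mem
      by_cases hd : ∃ i, t i = d
      · obtain ⟨i, rfl⟩ := hd
        exact Submodule.subset_span ⟨i, rfl⟩
      · push Not at hd
        obtain ⟨m, j, rfl⟩ := hmul _ d rfl hd
        by_cases hj : j = z
        · subst hj
          by_cases hm : m = 0
          · subst hm
            have h1 := hgI z
            rw [hgz, ← Ideal.Quotient.eq] at h1
            rw [zero_add, h1]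
            exact Submodule.subset_span ⟨L, rfl⟩
          · rw [Ideal.Quotient.eq_zero_iff_mem.2 (hzI m hm)]
            exact Submodule.zero_mem _
        · rw [Ideal.Quotient.eq_zero_iff_mem.2 (hnI m j hj)]
          exact Submodule.zero_mem _
end
end

section
/- Let O = {t_1,…,t_μ} be an order ideal in the monomials of x_1,…,x_n with border ∂O = {b_1,…,b_ν}. Then the following are equivalent: (b) deg(t_i) ≤ deg(b_j) for all i ∈ {1,…,μ} and j ∈ {1,…,ν}; (c) O has the generic Hilbert function, i.e., for every d ≥ 0, the number of elements of O of degree ≤ d equals min(μ, N_d), where N_d = binom(n+d, n) is the number of monomials of degree ≤ d in n indeterminates. -/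
open MvPolynomial

noncomputable section

theorem edeg_eq_degree {n : ℕ} (d : Fin n →₀ ℕ) : edeg d = d.degree := rfl

/-- The monomials of degree at most `d`. -/
def lowMon (n d : ℕ) : Finset (Fin n →₀ ℕ) := (Finsupp.finite_of_degree_le (σ := Fin n) d).toFinset

theorem mem_lowMon {n d : ℕ} (m : Fin n →₀ ℕ) : m ∈ lowMon n d ↔ edeg m ≤ d := by
  simp [lowMon, edeg_eq_degree]

theorem card_lowMon (n d : ℕ) : (lowMon n d).card = (n + d).choose n := by
  classical
  have h : lowMon n d = (Finset.range (d + 1)).biUnion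
      (fun k => Finset.finsuppAntidiag (Finset.univ : Finset (Fin n)) k) := by
    ext m
    rw [mem_lowMon, edeg_eq_degree, Finsupp.degree_eq_sum]
    simp [Finset.mem_finsuppAntidiag]
  rw [h, Finset.card_biUnion]
  · simp only [Finset.card_finsuppAntidiag_nat_eq_multichoose, Finset.card_univ, Fintype.card_fin]
    induction d with
    | zero => simp
    | succ d ih =>
      have h0 : lowMon n d = (Finset.range (d + 1)).biUnion
          (fun k => Finset.finsuppAntidiag (Finset.univ : Finset (Fin n)) k) := by
        ext m
        rw [mem_lowMon, edeg_eq_degree, Finsupp.degree_eq_sum]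
        simp [Finset.mem_finsuppAntidiag]
      rw [Finset.sum_range_succ, ih h0, Nat.multichoose_eq]
      rcases n with _ | n
      · simp
      · have e1 : n + 1 + (d + 1) - 1 = n + d + 1 := by omega
        have e2 : n + 1 + (d + 1) = (n + d + 1) + 1 := by omega
        have e3 : n + 1 + d = n + d + 1 := by omega
        rw [e1, e2, e3, Nat.choose_succ_succ (n + d + 1) n, add_comm]
        congr 1
        exact Nat.choose_symm_of_eq_add (by omega)
  · intro i _ j _ hij
    rw [Function.onFun, Finset.disjoint_left]
    intro m hm hm'
    rw [Finset.mem_finsuppAntidiag] at hm hm'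
    exact hij (hm.1.symm.trans hm'.1)

theorem border_divides {n μ ν : ℕ} (hμ : 0 < μ)
    (t : Fin μ → (Fin n →₀ ℕ)) (b : Fin ν → (Fin n →₀ ℕ))
    (horder : ∀ (i : Fin μ) (d : Fin n →₀ ℕ), d ≤ t i → ∃ j, t j = d)
    (hborder : ∀ d : Fin n →₀ ℕ,
      (∃ j, b j = d) ↔
        ((∃ (r : Fin n) (i : Fin μ), d = Finsupp.single r 1 + t i) ∧ ∀ i, t i ≠ d)) :
    ∀ (k : ℕ) (m : Fin n →₀ ℕ), m.degree = k → (∃ i, t i = m) ∨ ∃ j, b j ≤ m := by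
  intro k
  induction k with
  | zero =>
    intro m hm
    rw [Finsupp.degree_eq_zero_iff] at hm
    subst hm
    exact Or.inl (horder ⟨0, hμ⟩ 0 zero_le)
  | succ k ih =>
    intro m hm
    have hne : m ≠ 0 := by rintro rfl; simp at hm
    obtain ⟨r, hr⟩ := Finsupp.ne_iff.mp hne
    have hle : Finsupp.single r 1 ≤ m := by
      rw [Finsupp.single_le_iff]; simpa [Nat.one_le_iff_ne_zero] using hr
    obtain ⟨p, rfl⟩ := exists_add_of_le hle
    rw [map_add, Finsupp.degree_single] at hm
    rcases ih p (by omega) with ⟨i, rfl⟩ | ⟨j, hj⟩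
    · by_cases h : ∃ l, t l = Finsupp.single r 1 + t i
      · exact Or.inl h
      · push Not at h
        obtain ⟨j, hj⟩ := (hborder _).2 ⟨⟨r, i, rfl⟩, h⟩
        exact Or.inr ⟨j, hj.le⟩
    · exact Or.inr ⟨j, hj.trans le_add_self⟩

/-- Let `O = {t_1,…,t_μ}` be an order ideal with border `∂O = {b_1,…,b_ν}`.
The following are equivalent: (b) `deg(t_i) ≤ deg(b_j)` for all `i, j`;
(c) `O` has the generic Hilbert function, i.e. for every `d ≥ 0` the number of elements of `O`
of degree `≤ d` equals `min(μ, binom(n+d, n))`, where `binom(n+d,n)` is the number of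
monomials of degree `≤ d` in `n` indeterminates. -/
theorem maxdeg_border_iff_generic_hilbert_function
    (n μ ν : ℕ) (hμ : 0 < μ)
    (t : Fin μ → (Fin n →₀ ℕ)) (b : Fin ν → (Fin n →₀ ℕ))
    -- `t` enumerates an order ideal `O` (closed under division), with nondecreasing degrees
    (htinj : Function.Injective t)
    (horder : ∀ (i : Fin μ) (d : Fin n →₀ ℕ), d ≤ t i → ∃ j, t j = d)
    (hsort : Monotone fun i => edeg (t i))
    -- `b` enumerates the border `∂O = (x_1·O ∪ … ∪ x_n·O) \ O`
    (hbinj : Function.Injective b)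
    (hborder : ∀ d : Fin n →₀ ℕ,
      (∃ j, b j = d) ↔
        ((∃ (r : Fin n) (i : Fin μ), d = Finsupp.single r 1 + t i) ∧ ∀ i, t i ≠ d)) :
    (∀ (i : Fin μ) (j : Fin ν), edeg (t i) ≤ edeg (b j)) ↔
    (∀ d : ℕ, (Finset.univ.filter fun i : Fin μ => edeg (t i) ≤ d).card =
      min μ (Nat.choose (n + d) n)) := by
  classical
  have himg : ∀ d, ((Finset.univ.filter fun i : Fin μ => edeg (t i) ≤ d).image t).card =
      (Finset.univ.filter fun i : Fin μ => edeg (t i) ≤ d).card :=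
    fun d => Finset.card_image_of_injective _ htinj
  have hsub : ∀ d, (Finset.univ.filter fun i : Fin μ => edeg (t i) ≤ d).image t ⊆ lowMon n d := by
    intro d m hm
    obtain ⟨i, hi, rfl⟩ := Finset.mem_image.1 hm
    exact (mem_lowMon _).2 (Finset.mem_filter.1 hi).2
  have hN : ∀ d, (Finset.univ.filter fun i : Fin μ => edeg (t i) ≤ d).card ≤ (n + d).choose n := by
    intro d
    rw [← himg, ← card_lowMon]
    exact Finset.card_le_card (hsub d)
  have hM : ∀ d, (Finset.univ.filter fun i : Fin μ => edeg (t i) ≤ d).card ≤ μ := by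
    intro d
    simpa using Finset.card_filter_le (Finset.univ : Finset (Fin μ)) (fun i => edeg (t i) ≤ d)
  constructor
  · intro hb d
    apply le_antisymm (le_min (hM d) (hN d))
    by_cases hall : ∀ m : Fin n →₀ ℕ, edeg m ≤ d → ∃ i, t i = m
    · refine (min_le_right _ _).trans ?_
      rw [← himg, ← card_lowMon]
      apply Finset.card_le_card
      intro m hm
      rw [mem_lowMon] at hm
      obtain ⟨i, rfl⟩ := hall m hm
      exact Finset.mem_image_of_mem _ (by simpa using hm)
    · push Not at hall
      obtain ⟨m, hm, hmt⟩ := hall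
      rcases border_divides hμ t b horder hborder _ m rfl with ⟨i, hi⟩ | ⟨j, hj⟩
      · exact absurd hi (hmt i)
      · refine (min_le_left _ _).trans ?_
        rw [Finset.filter_true_of_mem]
        · simp
        · intro i _
          exact (hb i j).trans ((Finsupp.degree_mono hj).trans hm)
  · intro hc i j
    by_contra hlt
    push Not at hlt
    have h1 : (Finset.univ.filter fun i : Fin μ => edeg (t i) ≤ edeg (b j)).card < μ := by
      have := Finset.card_lt_card (Finset.filter_ssubset.2
        ⟨i, Finset.mem_univ i, not_le.2 hlt⟩ :
        (Finset.univ.filter fun i : Fin μ => edeg (t i) ≤ edeg (b j)) ⊂ Finset.univ)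
      simpa using this
    have h2 : (Finset.univ.filter fun i : Fin μ => edeg (t i) ≤ edeg (b j)).card <
        (n + edeg (b j)).choose n := by
      rw [← himg, ← card_lowMon]
      apply Finset.card_lt_card
      refine (Finset.ssubset_iff_of_subset (hsub _)).2 ⟨b j, (mem_lowMon _).2 le_rfl, ?_⟩
      intro hm
      obtain ⟨l, _, hl⟩ := Finset.mem_image.1 hm
      exact ((hborder (b j)).1 ⟨j, rfl⟩).2 l hl
    exact absurd (hc (edeg (b j))) (lt_min h1 h2).ne
end
end

section
/- Let K be a field, P = K[x_1,…,x_n], O = {t_1,…,t_μ} an order ideal, and let I ⊆ P be an ideal such that the residue classes of t_1,…,t_μ form a K-vector-space basis of P/I. Then for every i ≥ 0: #{t ∈ O : deg(t) ≤ i} ≤ dim_K F_i(P/I) ≤ min(μ, binom(n+i, n)). (Equivalently, the affine Hilbert function of P/I dominates the affine Hilbert function of O and is dominated by the generic affine Hilbert function HF^{(n,μ)}(i) = min(μ, dim_K F_iP).) -/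
open MvPolynomial

noncomputable section

/-- The degree filtration on `P/I`: `F_i(P/I)` is the image of the space of polynomials
of total degree at most `i` under the quotient map. -/
def degFil (K : Type*) [Field K] {n : ℕ} (I : Ideal (MvPolynomial (Fin n) K)) (i : ℕ) :
    Submodule K (MvPolynomial (Fin n) K ⧸ I) :=
  Submodule.map (Ideal.Quotient.mkₐ K I).toLinearMap
    (MvPolynomial.restrictTotalDegree (Fin n) K i)

theorem sum_multichoose_aux (n i : ℕ) :
    ∑ j ∈ Finset.range (i + 1), n.multichoose j = (n + i).choose n := by
  induction i with
  | zero => simp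
  | succ i ih =>
    rw [Finset.sum_range_succ, ih]
    cases n with
    | zero => simp
    | succ m =>
      rw [Nat.multichoose_eq, show m + 1 + (i + 1) - 1 = m + (i + 1) by omega,
        show m + 1 + (i + 1) = (m + (i + 1)) + 1 by omega, Nat.choose_succ_succ,
        show m + 1 + i = m + (i + 1) by omega,
        ← Nat.choose_symm_add (a := m) (b := i + 1), add_comm]

theorem finrank_restrictTotalDegree_le (K : Type*) [Field K] (n i : ℕ) :
    Module.finrank K (MvPolynomial.restrictTotalDegree (Fin n) K i) ≤ (n + i).choose n := by
  classical
  let S : Finset (Fin n →₀ ℕ) :=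
    (Finset.range (i + 1)).biUnion fun j => (Finset.univ : Finset (Fin n)).finsuppAntidiag j
  have hS : S.card ≤ (n + i).choose n := by
    refine Finset.card_biUnion_le.trans ?_
    rw [← sum_multichoose_aux]
    simp [Finset.card_finsuppAntidiag_nat_eq_multichoose]
  have hle : MvPolynomial.restrictTotalDegree (Fin n) K i ≤
      Submodule.span K ((S.image fun d => (monomial d (1 : K))) :
        Set (MvPolynomial (Fin n) K)) := by
    intro p hp
    rw [MvPolynomial.mem_restrictTotalDegree] at hp
    rw [p.as_sum]
    refine Submodule.sum_mem _ fun d hd => ?_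
    rw [show monomial d (coeff d p) = coeff d p • monomial d (1 : K) by
      simp [smul_monomial]]
    refine Submodule.smul_mem _ _ (Submodule.subset_span ?_)
    have h1 := (le_totalDegree hd).trans hp
    simp only [Finset.coe_image]
    refine ⟨d, ?_, rfl⟩
    simp only [S, Finset.mem_coe, Finset.mem_biUnion, Finset.mem_range,
      Finset.mem_finsuppAntidiag]
    refine ⟨_, Nat.lt_succ_of_le h1, ?_, Finset.subset_univ _⟩
    rw [Finsupp.sum_fintype] 
    simp
  exact (Submodule.finrank_mono hle).trans
    ((finrank_span_finset_le_card _).trans (Finset.card_image_le.trans hS))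

/-- Let `O = {t_1,…,t_μ}` be an order ideal and `I ⊆ P` an ideal such that
the residue classes of `t_1,…,t_μ` form a `K`-basis of `P/I`.  Then for every `i ≥ 0`,
`#{t ∈ O : deg(t) ≤ i} ≤ dim_K F_i(P/I) ≤ min(μ, binom(n+i, n))`; i.e. the affine Hilbert
function of `P/I` dominates the affine Hilbert function of `O` and is dominated by the generic
affine Hilbert function `HF^{(n,μ)}(i) = min(μ, dim_K F_iP)`. -/
theorem affine_hilbert_function_dominates_and_is_dominated
    (K : Type*) [Field K] (n μ : ℕ) (hμ : 0 < μ)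
    (t : Fin μ → (Fin n →₀ ℕ))
    -- `t` enumerates an order ideal `O` (closed under division), with nondecreasing degrees
    (htinj : Function.Injective t)
    (horder : ∀ (i : Fin μ) (d : Fin n →₀ ℕ), d ≤ t i → ∃ j, t j = d)
    (hsort : Monotone fun i => edeg (t i))
    -- the residue classes of `t_1,…,t_μ` form a `K`-basis of `P/I`
    (I : Ideal (MvPolynomial (Fin n) K))
    (hli : LinearIndependent K
      (fun i : Fin μ => Ideal.Quotient.mk I (monomial (t i) 1)))
    (hsp : Submodule.span K
      (Set.range fun i : Fin μ => Ideal.Quotient.mk I (monomial (t i) 1)) = ⊤) :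
    ∀ i : ℕ,
      (Finset.univ.filter fun j : Fin μ => edeg (t j) ≤ i).card ≤
        Module.finrank K ↥(degFil K I i) ∧
      Module.finrank K ↥(degFil K I i) ≤ min μ (Nat.choose (n + i) n) := by
  classical
  intro i
  have : Module.Finite K (MvPolynomial (Fin n) K ⧸ I) :=
    ⟨⟨Finset.univ.image fun i : Fin μ => Ideal.Quotient.mk I (monomial (t i) 1), by
      simpa using hsp⟩⟩
  refine ⟨?_, le_min ?_ ?_⟩
  · have h2 : LinearIndependent K
        (fun j : {j : Fin μ // edeg (t j) ≤ i} =>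
          (⟨Ideal.Quotient.mk I (monomial (t j.1) 1), by
            refine ⟨monomial (t j.1) 1, ?_, rfl⟩
            rw [SetLike.mem_coe, MvPolynomial.mem_restrictTotalDegree,
              totalDegree_monomial _ one_ne_zero]
            exact j.2⟩ : degFil K I i)) := by
      refine LinearIndependent.of_comp (degFil K I i).subtype ?_
      exact hli.comp _ Subtype.val_injective
    have := h2.fintype_card_le_finrank
    rwa [Fintype.card_subtype] at this
  · refine (Submodule.finrank_le _).trans ?_
    rw [← finrank_top, ← hsp]
    exact (finrank_range_le_card _).trans (by simp)
  · exact (Submodule.finrank_map_le _ _).trans (finrank_restrictTotalDegree_le K n i)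
end
end

section
/- Let K be a field, O = {t_1,…,t_μ} an order ideal in the monomials of x_1,…,x_n with border ∂O = {b_1,…,b_ν}, and C = {c_{ij}} the corresponding indeterminates. Let C^df = {c_{ij} : deg(t_i) ≤ deg(b_j)} and C^hom = {c_{ij} : deg(t_i) = deg(b_j)}. Let Ī(B_O^df) ⊆ K[C^df] be the ideal obtained from I(B_O) by substituting 0 for all variables not in C^df, and let Ī(B_O^hom) ⊆ K[C^hom] be the ideal obtained from I(B_O) by substituting 0 for all variables not in C^hom. Then, with respect to the total arrow degree grading on K[C^df] (in which the variables of C^hom are exactly the variables of degree 0): (i) Ī(B_O^hom) is exactly the set of homogeneous elements of degree zero of Ī(B_O^df); (ii) Ī(B_O^hom) = Ī(B_O^df) ∩ K[C^hom]; and (iii) Ī(B_O^hom)·K[C^df] ⊆ Ī(B_O^df). -/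
open MvPolynomial

noncomputable section

theorem edeg_single_add {n : ℕ} (r : Fin n) (d : Fin n →₀ ℕ) :
    edeg (Finsupp.single r 1 + d) = edeg d + 1 := by
  unfold edeg
  rw [Finsupp.sum_add_index' (by simp) (by simp)]
  simp [add_comm]

theorem hom_zero_part {σ τ K : Type*} [Field K] (w : σ → ℤ) (hw : ∀ v, 0 ≤ w v)
    (f : MvPolynomial σ K →ₐ[K] MvPolynomial τ K)
    (g : MvPolynomial τ K →ₐ[K] MvPolynomial σ K)
    (h0 : ∀ v, w v = 0 → g (f (X v)) = X v) (p : MvPolynomial σ K)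
    (hp : p.IsWeightedHomogeneous w 0) : g (f p) = p := by
  conv_rhs => rw [p.as_sum]
  conv_lhs => rw [p.as_sum, map_sum, map_sum]
  refine Finset.sum_congr rfl fun d hd => ?_
  have hd' := hp (mem_support_iff.1 hd)
  rw [Finsupp.weight_apply, Finsupp.sum,
    Finset.sum_eq_zero_iff_of_nonneg (fun v _ => nsmul_nonneg (hw v) _)] at hd'
  rw [monomial_eq, map_mul, map_mul, ← algebraMap_eq, AlgHom.commutes, algebraMap_eq,
    ← algebraMap_eq, AlgHom.commutes, Finsupp.prod, map_prod, map_prod]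
  congr 1
  refine Finset.prod_congr rfl fun v hv => ?_
  rw [map_pow, map_pow, h0 v]
  have := hd' v hv
  rw [smul_eq_zero] at this
  exact this.resolve_left (Finsupp.mem_support_iff.1 hv)

theorem hom_nonzero_part {σ τ K : Type*} [Field K] (w : σ → ℤ)
    (f : MvPolynomial σ K →ₐ[K] MvPolynomial τ K)
    (h0 : ∀ v, w v ≠ 0 → f (X v) = 0) (p : MvPolynomial σ K) (e : ℤ) (he : e ≠ 0)
    (hp : p.IsWeightedHomogeneous w e) : f p = 0 := by
  rw [p.as_sum, map_sum]
  refine Finset.sum_eq_zero fun d hd => ?_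
  have hd' := hp (mem_support_iff.1 hd)
  rw [Finsupp.weight_apply, Finsupp.sum] at hd'
  obtain ⟨v, hv, hne⟩ := Finset.exists_ne_zero_of_sum_ne_zero (hd'.trans_ne he)
  rw [monomial_eq, map_mul, Finsupp.prod, map_prod]
  rw [Finset.prod_eq_zero hv, mul_zero]
  rw [map_pow, h0 v (right_ne_zero_of_smul hne), zero_pow (Finsupp.mem_support_iff.1 hv)]

/-- In the setting of the border basis scheme, let
`C^df = {c_{ij} : deg(t_i) ≤ deg(b_j)}` and `C^hom = {c_{ij} : deg(t_i) = deg(b_j)}`, and let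
`Ī(B_O^df) ⊆ K[C^df]` and `Ī(B_O^hom) ⊆ K[C^hom]` be obtained from `I(B_O)` by substituting
`0` for all the other variables.  Identifying `K[C^hom]` with a subring of `K[C^df]`, with
respect to the total arrow degree grading: (i) `Ī(B_O^hom)` is exactly the set of homogeneous
elements of degree zero of `Ī(B_O^df)`; (ii) `Ī(B_O^hom) = Ī(B_O^df) ∩ K[C^hom]`; and
(iii) `Ī(B_O^hom)·K[C^df] ⊆ Ī(B_O^df)`. -/
theorem hom_ideal_is_degree_zero_part_of_df_ideal
    (K : Type*) [Field K] (n μ ν : ℕ) (hμ : 0 < μ)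
    (t : Fin μ → (Fin n →₀ ℕ)) (b : Fin ν → (Fin n →₀ ℕ))
    -- `t` enumerates an order ideal `O` (closed under division), with nondecreasing degrees
    (htinj : Function.Injective t)
    (horder : ∀ (i : Fin μ) (d : Fin n →₀ ℕ), d ≤ t i → ∃ j, t j = d)
    (hsort : Monotone fun i => edeg (t i))
    -- `b` enumerates the border `∂O = (x_1·O ∪ … ∪ x_n·O) \ O`
    (hbinj : Function.Injective b)
    (hborder : ∀ d : Fin n →₀ ℕ,
      (∃ j, b j = d) ↔
        ((∃ (r : Fin n) (i : Fin μ), d = Finsupp.single r 1 + t i) ∧ ∀ i, t i ≠ d))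
    -- the generic multiplication matrices `A_1, …, A_n` over `K[C]`
    (A : Fin n → Matrix (Fin μ) (Fin μ) (MvPolynomial (Fin μ × Fin ν) K))
    (hAt : ∀ (r : Fin n) (i j m : Fin μ), Finsupp.single r 1 + t j = t m →
      A r i j = if i = m then 1 else 0)
    (hAb : ∀ (r : Fin n) (i j : Fin μ) (m : Fin ν), Finsupp.single r 1 + t j = b m →
      A r i j = X (i, m))
    -- `I(B_O)` is generated by the entries of the commutators `A_r A_s - A_s A_r`, `r < s`
    (IBO : Ideal (MvPolynomial (Fin μ × Fin ν) K))
    (hIBO : IBO = Ideal.span {p | ∃ r s : Fin n, r < s ∧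
      ∃ i j : Fin μ, p = (A r * A s - A s * A r) i j})
    -- substitution `K[C] → K[C^df]` killing the variables `c_{ij}` with `deg(t_i) > deg(b_j)`
    (φdf : MvPolynomial (Fin μ × Fin ν) K →ₐ[K]
      MvPolynomial {v : Fin μ × Fin ν // edeg (t v.1) ≤ edeg (b v.2)} K)
    (hφdf : ∀ v : Fin μ × Fin ν, φdf (X v) =
      if h : edeg (t v.1) ≤ edeg (b v.2) then X ⟨v, h⟩ else 0)
    -- substitution `K[C] → K[C^hom]` killing the variables `c_{ij}` with `deg(t_i) ≠ deg(b_j)`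
    (φhom : MvPolynomial (Fin μ × Fin ν) K →ₐ[K]
      MvPolynomial {v : Fin μ × Fin ν // edeg (t v.1) = edeg (b v.2)} K)
    (hφhom : ∀ v : Fin μ × Fin ν, φhom (X v) =
      if h : edeg (t v.1) = edeg (b v.2) then X ⟨v, h⟩ else 0)
    -- the inclusion `K[C^hom] ⊆ K[C^df]`
    (ι : MvPolynomial {v : Fin μ × Fin ν // edeg (t v.1) = edeg (b v.2)} K →ₐ[K]
      MvPolynomial {v : Fin μ × Fin ν // edeg (t v.1) ≤ edeg (b v.2)} K)
    (hι : ∀ v : {v : Fin μ × Fin ν // edeg (t v.1) = edeg (b v.2)},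
      ι (X v) = X ⟨v.1, le_of_eq v.2⟩)
    -- the ideals `Ī(B_O^df)` and `Ī(B_O^hom)`
    (Idf : Ideal (MvPolynomial {v : Fin μ × Fin ν // edeg (t v.1) ≤ edeg (b v.2)} K))
    (hIdf : Idf = Ideal.map φdf.toRingHom IBO)
    (Ihom : Ideal (MvPolynomial {v : Fin μ × Fin ν // edeg (t v.1) = edeg (b v.2)} K))
    (hIhom : Ihom = Ideal.map φhom.toRingHom IBO)
    -- the total arrow degree on `K[C^df]`
    (wdf : {v : Fin μ × Fin ν // edeg (t v.1) ≤ edeg (b v.2)} → ℤ)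
    (hwdf : ∀ v, wdf v = (edeg (b v.1.2) : ℤ) - (edeg (t v.1.1) : ℤ)) :
    -- (i): `Ī(B_O^hom)` is the set of degree-zero homogeneous elements of `Ī(B_O^df)`
    (⇑ι '' (Ihom : Set (MvPolynomial
        {v : Fin μ × Fin ν // edeg (t v.1) = edeg (b v.2)} K)) =
      {p | p ∈ Idf ∧ p.IsWeightedHomogeneous wdf 0}) ∧
    -- (ii): `Ī(B_O^hom) = Ī(B_O^df) ∩ K[C^hom]`
    (Ideal.comap ι.toRingHom Idf = Ihom) ∧
    -- (iii): `Ī(B_O^hom)·K[C^df] ⊆ Ī(B_O^df)`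
    (Ideal.map ι.toRingHom Ihom ≤ Idf) := by
  classical
  have hw : ∀ v, 0 ≤ wdf v := fun v => by
    have := v.2
    rw [hwdf]; omega
  obtain ⟨ψ, hψ⟩ : ∃ ψ : MvPolynomial {v : Fin μ × Fin ν // edeg (t v.1) ≤ edeg (b v.2)} K →ₐ[K]
      MvPolynomial {v : Fin μ × Fin ν // edeg (t v.1) = edeg (b v.2)} K,
      ∀ v, ψ (X v) = if h : edeg (t v.1.1) = edeg (b v.1.2) then X ⟨v.1, h⟩ else 0 :=
    ⟨aeval fun v => if h : edeg (t v.1.1) = edeg (b v.1.2) then X ⟨v.1, h⟩ else 0,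
      fun v => aeval_X _ v⟩
  have hψι : ∀ p, ψ (ι p) = p := by
    have : ψ.comp ι = AlgHom.id K _ := by
      apply MvPolynomial.algHom_ext
      intro v
      simp [hι, hψ, v.2]
    exact fun p => DFunLike.congr_fun this p
  have hψφ : ∀ p, ψ (φdf p) = φhom p := by
    have : ψ.comp φdf = φhom := by
      apply MvPolynomial.algHom_ext
      intro v
      rw [AlgHom.comp_apply, hφdf, hφhom]
      split_ifs with h1 h2 h2
      · simp [hψ, h2]
      · simp [hψ, h2]
      · omega
      · simp
    exact fun p => DFunLike.congr_fun this p
  have hz : ∀ p, p.IsWeightedHomogeneous wdf 0 → ι (ψ p) = p := by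
    refine fun p hp => hom_zero_part wdf hw ψ ι (fun v hv => ?_) p hp
    rw [hwdf] at hv
    have h : edeg (t v.1.1) = edeg (b v.1.2) := by omega
    rw [hψ, dif_pos h, hι]
  have hnz : ∀ p e, e ≠ 0 → p.IsWeightedHomogeneous wdf e → ψ p = 0 := by
    refine fun p e he hp => hom_nonzero_part wdf ψ (fun v hv => ?_) p e he hp
    rw [hwdf] at hv
    have h : ¬ edeg (t v.1.1) = edeg (b v.1.2) := by omega
    rw [hψ, dif_neg h]
  have hιh : ∀ p, (ι p).IsWeightedHomogeneous wdf 0 := by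
    intro p
    induction p using MvPolynomial.induction_on with
    | C a =>
      rw [← algebraMap_eq, AlgHom.commutes, algebraMap_eq]
      exact isWeightedHomogeneous_C _ _
    | add p q hp hq => rw [map_add]; exact hp.add hq
    | mul_X p v hp =>
      rw [map_mul, hι]
      have h := isWeightedHomogeneous_X K wdf ⟨v.1, le_of_eq v.2⟩
      have h2 : wdf ⟨v.1, le_of_eq v.2⟩ = 0 := by
        have := v.2
        rw [hwdf]; simp only; omega
      rw [h2] at h
      simpa using hp.mul h
  have hA : ∀ r i j, (φdf (A r i j)).IsWeightedHomogeneous wdf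
      ((edeg (t j) : ℤ) + 1 - edeg (t i)) := by
    intro r i j
    by_cases hm : ∃ m, t m = Finsupp.single r 1 + t j
    · obtain ⟨m, hm⟩ := hm
      rw [hAt r i j m hm.symm]
      split_ifs with h
      · subst h
        have : (edeg (t j) : ℤ) + 1 - edeg (t i) = 0 := by
          rw [hm, edeg_single_add]; push_cast; ring
        rw [this, map_one]
        exact isWeightedHomogeneous_one _ _
      · rw [map_zero]; exact isWeightedHomogeneous_zero _ _ _
    · obtain ⟨m, hb⟩ := (hborder (Finsupp.single r 1 + t j)).2
        ⟨⟨r, j, rfl⟩, fun i h => hm ⟨i, h⟩⟩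
      rw [hAb r i j m hb.symm, hφdf]
      split_ifs with h
      · have h' := isWeightedHomogeneous_X K wdf ⟨(i, m), h⟩
        rw [hwdf] at h'
        simp only [hb, edeg_single_add] at h'
        exact_mod_cast h'
      · exact isWeightedHomogeneous_zero _ _ _
  have hmul : ∀ r s i j, (φdf ((A r * A s) i j)).IsWeightedHomogeneous wdf
      ((edeg (t j) : ℤ) + 2 - edeg (t i)) := by
    intro r s i j
    rw [Matrix.mul_apply, map_sum]
    refine IsWeightedHomogeneous.sum _ _ _ fun k _ => ?_
    rw [map_mul]
    have := (hA r i k).mul (hA s k j)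
    convert this using 1
    ring
  have h3 : Ideal.map ι.toRingHom Ihom ≤ Idf := by
    rw [hIhom, hIBO, Ideal.map_span, Ideal.map_span, Ideal.span_le]
    rintro _ ⟨_, ⟨p, ⟨r, s, hrs, i, j, rfl⟩, rfl⟩, rfl⟩
    change ι (φhom _) ∈ Idf
    rw [← hψφ]
    have hh : (φdf ((A r * A s - A s * A r) i j)).IsWeightedHomogeneous wdf
        ((edeg (t j) : ℤ) + 2 - edeg (t i)) := by
      rw [Matrix.sub_apply, map_sub]
      exact (weightedHomogeneousSubmodule K wdf _).sub_mem (hmul r s i j) (hmul s r i j)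
    by_cases he : (edeg (t j) : ℤ) + 2 - edeg (t i) = 0
    · rw [he] at hh
      rw [hz _ hh, hIdf, hIBO]
      exact Ideal.mem_map_of_mem φdf.toRingHom (Ideal.subset_span ⟨r, s, hrs, i, j, rfl⟩)
    · rw [hnz _ _ he hh, map_zero]
      exact Idf.zero_mem
  have hψI : ∀ p ∈ Idf, ψ p ∈ Ihom := by
    have : Idf ≤ Ideal.comap ψ.toRingHom Ihom := by
      rw [hIdf, Ideal.map_le_iff_le_comap]
      intro p hp
      change ψ (φdf p) ∈ Ihom
      rw [hψφ, hIhom]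
      exact Ideal.mem_map_of_mem φhom.toRingHom hp
    exact fun p hp => this hp
  have hιI : ∀ p ∈ Ihom, ι p ∈ Idf := fun p hp => h3 (Ideal.mem_map_of_mem ι.toRingHom hp)
  refine ⟨?_, ?_, h3⟩
  · ext p
    constructor
    · rintro ⟨q, hq, rfl⟩
      exact ⟨hιI q hq, hιh q⟩
    · rintro ⟨hp, hh⟩
      exact ⟨ψ p, hψI p hp, hz p hh⟩
  · ext p
    constructor
    · intro hp
      have := hψI (ι p) hp
      rwa [hψι] at this
    · exact fun hp => hιI p hp
end
end

section
/- Let K be a field, O = {t_1,…,t_μ} an order ideal in the monomials of x_1,…,x_n with border ∂O = {b_1,…,b_ν}, and let A_1^df, …, A_n^df be the generic degree filtered multiplication matrices, obtained from the generic multiplication matrices A_1,…,A_n by substituting 0 for every variable c_{ij} with deg(t_i) > deg(b_j). Then for all 1 ≤ r < s ≤ n, every entry of the commutator A_r^df A_s^df − A_s^df A_r^df is either the zero polynomial or a homogeneous polynomial of non-negative total arrow degree; consequently the total arrow degree induces a non-negative ℤ-grading on B_O^df = K[C^df]/Ī(B_O^df). -/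
open MvPolynomial

noncomputable section

/-- Let `A_1^df, …, A_n^df` be the generic degree filtered multiplication
matrices, obtained from the generic multiplication matrices by substituting `0` for every
variable `c_{ij}` with `deg(t_i) > deg(b_j)`.  Then every entry of a commutator
`A_r^df A_s^df - A_s^df A_r^df` (for `r < s`) is either zero or homogeneous of non-negative
total arrow degree; consequently the total arrow degree induces a non-negative `ℤ`-grading on
`B_O^df = K[C^df]/Ī(B_O^df)`: all of `K[C^df]` lives in non-negative degrees and the ideal
`Ī(B_O^df)` is homogeneous (closed under taking weighted homogeneous components). -/
theorem df_commutator_entries_nonneg_arrow_degree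
    (K : Type*) [Field K] (n μ ν : ℕ) (hμ : 0 < μ)
    (t : Fin μ → (Fin n →₀ ℕ)) (b : Fin ν → (Fin n →₀ ℕ))
    -- `t` enumerates an order ideal `O` (closed under division), with nondecreasing degrees
    (htinj : Function.Injective t)
    (horder : ∀ (i : Fin μ) (d : Fin n →₀ ℕ), d ≤ t i → ∃ j, t j = d)
    (hsort : Monotone fun i => edeg (t i))
    -- `b` enumerates the border `∂O = (x_1·O ∪ … ∪ x_n·O) \ O`
    (hbinj : Function.Injective b)
    (hborder : ∀ d : Fin n →₀ ℕ,
      (∃ j, b j = d) ↔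
        ((∃ (r : Fin n) (i : Fin μ), d = Finsupp.single r 1 + t i) ∧ ∀ i, t i ≠ d))
    -- the generic multiplication matrices `A_1, …, A_n` over `K[C]`
    (A : Fin n → Matrix (Fin μ) (Fin μ) (MvPolynomial (Fin μ × Fin ν) K))
    (hAt : ∀ (r : Fin n) (i j m : Fin μ), Finsupp.single r 1 + t j = t m →
      A r i j = if i = m then 1 else 0)
    (hAb : ∀ (r : Fin n) (i j : Fin μ) (m : Fin ν), Finsupp.single r 1 + t j = b m →
      A r i j = X (i, m))
    -- substitution `K[C] → K[C^df]` killing the variables `c_{ij}` with `deg(t_i) > deg(b_j)`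
    (φdf : MvPolynomial (Fin μ × Fin ν) K →ₐ[K]
      MvPolynomial {v : Fin μ × Fin ν // edeg (t v.1) ≤ edeg (b v.2)} K)
    (hφdf : ∀ v : Fin μ × Fin ν, φdf (X v) =
      if h : edeg (t v.1) ≤ edeg (b v.2) then X ⟨v, h⟩ else 0)
    -- the generic degree filtered multiplication matrices `A_1^df, …, A_n^df`
    (Adf : Fin n → Matrix (Fin μ) (Fin μ)
      (MvPolynomial {v : Fin μ × Fin ν // edeg (t v.1) ≤ edeg (b v.2)} K))
    (hAdf : ∀ r : Fin n, Adf r = (A r).map φdf)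
    -- the ideal `Ī(B_O^df)`, i.e. the image of `I(B_O)` under the substitution
    (Idf : Ideal (MvPolynomial {v : Fin μ × Fin ν // edeg (t v.1) ≤ edeg (b v.2)} K))
    (hIdf : Idf = Ideal.map φdf.toRingHom
      (Ideal.span {p | ∃ r s : Fin n, r < s ∧
        ∃ i j : Fin μ, p = (A r * A s - A s * A r) i j}))
    -- the total arrow degree on `K[C^df]`
    (wdf : {v : Fin μ × Fin ν // edeg (t v.1) ≤ edeg (b v.2)} → ℤ)
    (hwdf : ∀ v, wdf v = (edeg (b v.1.2) : ℤ) - (edeg (t v.1.1) : ℤ)) :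
    -- every commutator entry is zero or homogeneous of non-negative total arrow degree …
    (∀ r s : Fin n, r < s → ∀ i j : Fin μ,
      (Adf r * Adf s - Adf s * Adf r) i j = 0 ∨
      ∃ d : ℤ, 0 ≤ d ∧
        ((Adf r * Adf s - Adf s * Adf r) i j).IsWeightedHomogeneous wdf d) ∧
    -- … consequently the total arrow degree induces a non-negative grading on `B_O^df`:
    -- `K[C^df]` has no nonzero components of negative degree …
    (∀ (p : MvPolynomial {v : Fin μ × Fin ν // edeg (t v.1) ≤ edeg (b v.2)} K) (d : ℤ),
      d < 0 → weightedHomogeneousComponent wdf d p = 0) ∧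
    -- … and `Ī(B_O^df)` is a homogeneous ideal, so the grading descends to the quotient
    (∀ (d : ℤ) (p : MvPolynomial {v : Fin μ × Fin ν // edeg (t v.1) ≤ edeg (b v.2)} K),
      p ∈ Idf → weightedHomogeneousComponent wdf d p ∈ Idf) := by
  classical
  have hdeg : ∀ (r : Fin n) (d : Fin n →₀ ℕ), edeg (Finsupp.single r 1 + d) = 1 + edeg d := by
    intro r d
    unfold edeg
    rw [Finsupp.sum_add_index' (fun _ => rfl) (fun _ _ _ => rfl),
      Finsupp.sum_single_index rfl]
  have hw0 : ∀ v, 0 ≤ wdf v := by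
    intro v
    have h1 := v.2
    rw [hwdf v]
    omega
  have hweight : ∀ e : _ →₀ ℕ, 0 ≤ Finsupp.weight wdf e := by
    intro e
    rw [Finsupp.weight_apply]
    exact Finsupp.sum_nonneg fun v _ => nsmul_nonneg (hw0 v) _
  have hentry : ∀ (r : Fin n) (i j : Fin μ),
      (Adf r i j).IsWeightedHomogeneous wdf (1 + (edeg (t j) : ℤ) - (edeg (t i) : ℤ)) := by
    intro r i j
    rw [hAdf r, Matrix.map_apply]
    by_cases h : ∃ m, t m = Finsupp.single r 1 + t j
    · obtain ⟨m, hm⟩ := h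
      rw [hAt r i j m hm.symm]
      have hd := hdeg r (t j)
      rw [← hm] at hd
      split_ifs with him
      · subst him
        rw [map_one]
        have h0 : (1 + (edeg (t j) : ℤ) - (edeg (t i) : ℤ)) = 0 := by omega
        rw [h0]
        exact isWeightedHomogeneous_one K wdf
      · rw [map_zero]
        exact isWeightedHomogeneous_zero K wdf _
    · push Not at h
      obtain ⟨m, hm⟩ := (hborder (Finsupp.single r 1 + t j)).2 ⟨⟨r, j, rfl⟩, h⟩
      rw [hAb r i j m hm.symm, hφdf]
      have hd := hdeg r (t j)
      rw [← hm] at hd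
      split_ifs with hle
      · have h0 : (1 + (edeg (t j) : ℤ) - (edeg (t i) : ℤ)) = wdf ⟨(i, m), hle⟩ := by
          rw [hwdf]
          simp only
          omega
        rw [h0]
        exact isWeightedHomogeneous_X K wdf _
      · exact isWeightedHomogeneous_zero K wdf _
  have hprod : ∀ (r s : Fin n) (i j : Fin μ),
      ((Adf r * Adf s) i j).IsWeightedHomogeneous wdf
        (2 + (edeg (t j) : ℤ) - (edeg (t i) : ℤ)) := by
    intro r s i j
    rw [Matrix.mul_apply]
    refine IsWeightedHomogeneous.sum _ _ _ fun k _ => ?_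
    have h := (hentry r i k).mul (hentry s k j)
    convert h using 1
    ring
  have hcomm : ∀ (r s : Fin n) (i j : Fin μ),
      ((Adf r * Adf s - Adf s * Adf r) i j).IsWeightedHomogeneous wdf
        (2 + (edeg (t j) : ℤ) - (edeg (t i) : ℤ)) := by
    intro r s i j
    rw [Matrix.sub_apply]
    exact (hprod r s i j).sub (hprod s r i j)
  refine ⟨?_, ?_, ?_⟩
  · intro r s _ i j
    by_cases h0 : 0 ≤ 2 + (edeg (t j) : ℤ) - (edeg (t i) : ℤ)
    · exact Or.inr ⟨_, h0, hcomm r s i j⟩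
    · left
      ext e
      rw [coeff_zero]
      refine (hcomm r s i j).coeff_eq_zero e ?_
      have := hweight e
      omega
  · intro p d hd
    refine weightedHomogeneousComponent_eq_zero' _ _ fun e _ => ?_
    have := hweight e
    omega
  · intro d p hp
    let _ := weightedGradedAlgebra K wdf
    refine weightedHomogeneousComponent_mem_of_mem K wdf ?_ hp d
    rw [hIdf, Ideal.map_span]
    refine Ideal.homogeneous_span _ _ ?_
    rintro _ ⟨q, ⟨r, s, _, i, j, rfl⟩, rfl⟩
    refine ⟨2 + (edeg (t j) : ℤ) - (edeg (t i) : ℤ), (mem_weightedHomogeneousSubmodule K wdf _ _).2 ?_⟩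
    · have h := hcomm r s i j
      have he : φdf.toRingHom ((A r * A s - A s * A r) i j)
          = (Adf r * Adf s - Adf s * Adf r) i j := by
        simp [hAdf, Matrix.mul_apply, Matrix.sub_apply]
      rw [he]
      exact h
end
end

section
/- Let K be a field, P = K[x_1,…,x_n], O = {t_1,…,t_μ} an order ideal, and let I ⊆ P be a zero-dimensional ideal such that the residue classes of t_1,…,t_μ form a K-basis of P/I; let M_1, …, M_n ∈ Mat_μ(K) be the matrices representing multiplication by x_1, …, x_n on P/I with respect to this basis. Let t'_1, …, t'_μ be any μ monomials of P and let T' ∈ Mat_μ(K) be the matrix whose i-th column is the first column of t'_i(M_1,…,M_n). Then the residue classes of t'_1,…,t'_μ form a K-basis of P/I if and only if det(T') ≠ 0. -/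
open MvPolynomial

noncomputable section

/-- Evaluation of the monomial with exponent vector `d` at the tuple of (commuting) matrices
`M_1, …, M_n`, i.e. `M_1^{d_1} ⋯ M_n^{d_n}`. -/
def matPow {K : Type*} [CommRing K] {n μ : ℕ} (M : Fin n → Matrix (Fin μ) (Fin μ) K)
    (d : Fin n →₀ ℕ) : Matrix (Fin μ) (Fin μ) K :=
  ((List.finRange n).map fun r => M r ^ d r).prod

/-- Let `O = {t_1,…,t_μ}` be an order ideal whose residue classes form a
`K`-basis of `P/I`, and let `M_1,…,M_n` be the corresponding multiplication matrices.  Let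
`t'_1,…,t'_μ` be any `μ` monomials and `T'` the matrix whose `i`-th column is the first
column of `t'_i(M_1,…,M_n)`.  Then the residue classes of `t'_1,…,t'_μ` form a `K`-basis of
`P/I` if and only if `det(T') ≠ 0`. -/
theorem new_monomials_basis_iff_det_ne_zero
    (K : Type*) [Field K] (n μ : ℕ) (hμ : 0 < μ)
    (t : Fin μ → (Fin n →₀ ℕ))
    -- `t` enumerates an order ideal `O` (closed under division), sorted, with `t_1 = 1`
    (htinj : Function.Injective t)
    (horder : ∀ (i : Fin μ) (d : Fin n →₀ ℕ), d ≤ t i → ∃ j, t j = d)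
    (hsort : Monotone fun i => edeg (t i))
    (ht1 : t ⟨0, hμ⟩ = 0)
    -- the residue classes of `t_1,…,t_μ` form a `K`-basis of `P/I`
    (I : Ideal (MvPolynomial (Fin n) K))
    (hli : LinearIndependent K
      (fun i : Fin μ => Ideal.Quotient.mk I (monomial (t i) 1)))
    (hsp : Submodule.span K
      (Set.range fun i : Fin μ => Ideal.Quotient.mk I (monomial (t i) 1)) = ⊤)
    -- `M_r` represents multiplication by `x_r` on `P/I` in this basis
    (M : Fin n → Matrix (Fin μ) (Fin μ) K)
    (hM : ∀ (r : Fin n) (j : Fin μ),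
      Ideal.Quotient.mk I (monomial (Finsupp.single r 1 + t j) 1) =
        ∑ i : Fin μ, M r i j • Ideal.Quotient.mk I (monomial (t i) 1))
    -- any `μ` monomials `t'_1,…,t'_μ` and the matrix `T'` whose `i`-th column is the
    -- first column of `t'_i(M_1,…,M_n)`
    (t' : Fin μ → (Fin n →₀ ℕ))
    (T' : Matrix (Fin μ) (Fin μ) K)
    (hT' : ∀ i j : Fin μ, T' i j = matPow M (t' j) i ⟨0, hμ⟩) :
    (LinearIndependent K
        (fun i : Fin μ => Ideal.Quotient.mk I (monomial (t' i) 1)) ∧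
      Submodule.span K
        (Set.range fun i : Fin μ => Ideal.Quotient.mk I (monomial (t' i) 1)) = ⊤) ↔
    T'.det ≠ 0 := by
  classical
  let b : Module.Basis (Fin μ) K (MvPolynomial (Fin n) K ⧸ I) := Module.Basis.mk hli hsp.ge
  have hb : ∀ i, b i = Ideal.Quotient.mk I (monomial (t i) 1) := fun i => by
    simp [b]
  have hMr : ∀ r, M r = Algebra.leftMulMatrix b (Ideal.Quotient.mk I (X r)) := by
    intro r
    ext i j
    rw [Algebra.leftMulMatrix_eq_repr_mul, hb, ← map_mul]
    have h1 : (X r * monomial (t j) 1 : MvPolynomial (Fin n) K)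
        = monomial (Finsupp.single r 1 + t j) 1 := by
      rw [X, monomial_mul, one_mul]
    rw [h1, hM]
    simp only [← hb]
    rw [b.repr_sum_self]
  have hpow : ∀ d, matPow M d
      = Algebra.leftMulMatrix b (Ideal.Quotient.mk I (monomial d 1)) := by
    intro d
    have h2 : (monomial d 1 : MvPolynomial (Fin n) K)
        = ((List.finRange n).map fun r => X r ^ d r).prod := by
      rw [← Fin.prod_univ_def, monomial_eq, Finsupp.prod_fintype _ _ (by simp)]
      simp
    rw [h2, map_list_prod, map_list_prod, matPow, List.map_map, List.map_map]
    congr 2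
    funext r
    simp [hMr]
  have hT : T' = b.toMatrix (fun i => Ideal.Quotient.mk I (monomial (t' i) 1)) := by
    ext i j
    have h0 : (Ideal.Quotient.mk I) (monomial (0 : Fin n →₀ ℕ) (1 : K)) = 1 := map_one _
    rw [hT', hpow, Algebra.leftMulMatrix_eq_repr_mul, hb, ht1, h0, mul_one,
      Module.Basis.toMatrix_apply]
  rw [Module.Basis.is_basis_iff_det b, Module.Basis.det_apply, ← hT, isUnit_iff_ne_zero]
end
end

section
/- Let K be a field, P = K[x_1,…,x_n], let I ⊆ P be a zero-dimensional ideal, and let O' = {t'_1,…,t'_μ} be an order ideal such that for every i ≥ 0 the number of elements of O' of degree ≤ i equals dim_K F_i(P/I). Then the residue classes of t'_1,…,t'_μ form a degree filtered K-basis of P/I if and only if they form a K-vector-space basis of P/I. -/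
open MvPolynomial

noncomputable section

/-- A family `v` of elements of `P/I` is a degree filtered `K`-basis if, for every `i ≥ 0`,
those of its members lying in `F_i(P/I)` form a `K`-basis of `F_i(P/I)`. -/
def IsDegFilteredBasis (K : Type*) [Field K] {n : ℕ} (I : Ideal (MvPolynomial (Fin n) K))
    {ι : Type*} (v : ι → MvPolynomial (Fin n) K ⧸ I) : Prop :=
  ∀ i : ℕ,
    LinearIndependent K (fun j : {j : ι // v j ∈ degFil K I i} => v j.1) ∧
    Submodule.span K (Set.range fun j : {j : ι // v j ∈ degFil K I i} => v j.1) = degFil K I i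

/-- Let `I ⊆ P` be a zero-dimensional ideal and let `O' = {t'_1,…,t'_μ}` be
an order ideal such that, for every `i ≥ 0`, the number of elements of `O'` of degree `≤ i`
equals `dim_K F_i(P/I)`.  Then the residue classes of `t'_1,…,t'_μ` form a degree filtered
`K`-basis of `P/I` if and only if they form a `K`-vector-space basis of `P/I`. -/
theorem degree_filtered_basis_iff_basis_of_matching_counts
    (K : Type*) [Field K] (n μ : ℕ)
    (t' : Fin μ → (Fin n →₀ ℕ))
    -- `t'` enumerates an order ideal `O'` (closed under division), with nondecreasing degrees
    (htinj : Function.Injective t')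
    (horder : ∀ (i : Fin μ) (d : Fin n →₀ ℕ), d ≤ t' i → ∃ j, t' j = d)
    (hsort : Monotone fun i => edeg (t' i))
    -- `I` is a zero-dimensional ideal of `P`
    (I : Ideal (MvPolynomial (Fin n) K))
    (hI : FiniteDimensional K (MvPolynomial (Fin n) K ⧸ I))
    -- the number of elements of `O'` of degree `≤ i` equals `dim_K F_i(P/I)` for all `i`
    (hcount : ∀ i : ℕ, (Finset.univ.filter fun j : Fin μ => edeg (t' j) ≤ i).card =
      Module.finrank K ↥(degFil K I i)) :
    IsDegFilteredBasis K I (fun j : Fin μ => Ideal.Quotient.mk I (monomial (t' j) 1)) ↔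
    (LinearIndependent K
        (fun j : Fin μ => Ideal.Quotient.mk I (monomial (t' j) 1)) ∧
      Submodule.span K
        (Set.range fun j : Fin μ => Ideal.Quotient.mk I (monomial (t' j) 1)) = ⊤) := by
  have hmem : ∀ (j : Fin μ) (i : ℕ), edeg (t' j) ≤ i →
      (Ideal.Quotient.mk I (monomial (t' j) 1)) ∈ degFil K I i := by
    intro j i hj
    refine Submodule.mem_map.2 ⟨monomial (t' j) 1, ?_, rfl⟩
    rw [MvPolynomial.mem_restrictTotalDegree]
    exact (MvPolynomial.totalDegree_monomial_le _ _).trans hj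
  constructor
  · intro h
    constructor
    · have hall : ∀ j : Fin μ, (Ideal.Quotient.mk I (monomial (t' j) 1)) ∈
          degFil K I (Finset.univ.sup fun j => edeg (t' j)) := fun j =>
        hmem j _ (Finset.le_sup (f := fun j => edeg (t' j)) (Finset.mem_univ j))
      exact (h (Finset.univ.sup fun j => edeg (t' j))).1.comp
        (fun j : Fin μ => ⟨j, hall j⟩) (fun a b hab => congrArg Subtype.val hab)
    · rw [eq_top_iff]
      rintro x -
      obtain ⟨p, rfl⟩ := Ideal.Quotient.mk_surjective x
      have hp : Ideal.Quotient.mk I p ∈ degFil K I p.totalDegree :=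
        Submodule.mem_map.2 ⟨p, (MvPolynomial.mem_restrictTotalDegree _ _ _).2 le_rfl, rfl⟩
      rw [← (h p.totalDegree).2] at hp
      refine Submodule.span_mono ?_ hp
      rintro _ ⟨j, rfl⟩
      exact ⟨j.1, rfl⟩
  · rintro ⟨hli, -⟩ i
    classical
    have hli' := hli.comp (Subtype.val : {j : Fin μ //
      (Ideal.Quotient.mk I (monomial (t' j) 1)) ∈ degFil K I i} → Fin μ)
      Subtype.val_injective
    refine ⟨hli', ?_⟩
    apply Submodule.eq_of_le_of_finrank_le
    · rw [Submodule.span_le]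
      rintro _ ⟨j, rfl⟩
      exact j.2
    · have hc := finrank_span_eq_card hli'
      refine le_trans ?_ hc.ge
      rw [← hcount i, Fintype.card_subtype]
      apply Finset.card_le_card
      intro j hj
      simp only [Finset.mem_filter, Finset.mem_univ, true_and] at hj ⊢
      exact hmem j i hj
end
end
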